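/- Under Assumptions (A) and (B), suppose in addition that min_{1≤i≤d} (1/G_{ii})(√μ_i − √ν_i)² = (1/G_{11})(√μ_1 − √ν_1)². Let α ∈ B_{{1}} be such that {2,…,d} \ J(α) ≠ ∅. Then for any i ∈ {2,…,d} \ J(α) there exists α̃ ∈ B_{{1}} such that J(α) ∪ {i} ⊆ J(α̃) and R(α̃) < max{ R(α), −(1/G_{ii})(√μ_i − √ν_i)² }. -/

import Mathlib

open scoped BigOperators
open Filter

/-- The `i`-th standard unit vector in `ℤ^d`. -/
def unitZ {d : ℕ} (i : Fin d) : Fin d → ℤ := fun k => if k = i then 1 else 0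

/-- The jump rates `q(y)` of the Jackson network: `q(ε^i) = λ_i`,
`q(-ε^i) = μ_i p_{i0}`, `q(ε^j - ε^i) = μ_i p_{ij}` and `q(y) = 0` otherwise. -/
noncomputable def qrate {d : ℕ} (lam mu : Fin d → ℝ) (P : Fin d → Fin d → ℝ)
    (y : Fin d → ℤ) : ℝ :=
  (∑ i, lam i * (if y = unitZ i then 1 else 0))
    + (∑ i, mu i * (1 - ∑ j, P i j) * (if y = -unitZ i then 1 else 0))
    + (∑ i, ∑ j, mu i * P i j * (if y = unitZ j - unitZ i then 1 else 0))

/-- Assumption (A): irreducibility of the matrix `(q(x - y); x, y ∈ ℤ^d)`. -/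
def AssumptionA {d : ℕ} (lam mu : Fin d → ℝ) (P : Fin d → Fin d → ℝ) : Prop :=
  ∀ x y : Fin d → ℤ, ∃ (n : ℕ) (c : Fin (n + 1) → Fin d → ℤ),
    c 0 = x ∧ c (Fin.last n) = y ∧
      ∀ k : Fin n, 0 < qrate lam mu P (c k.succ - c k.castSucc)

/-- The generator `ℒ` of the Jackson network:
`(ℒ f)(x) = ∑_{z ∈ ℤ_+^d} q(z - x) (f z - f x)`. -/
noncomputable def gen {d : ℕ} (lam mu : Fin d → ℝ) (P : Fin d → Fin d → ℝ)
    (f : (Fin d → ℕ) → ℝ) (x : Fin d → ℕ) : ℝ :=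
  ∑' z : Fin d → ℕ, qrate lam mu P (fun k => (z k : ℤ) - (x k : ℤ)) * (f z - f x)

/-- The hitting-probability matrix `Q j i = G j i / G i i`. -/
noncomputable def hitQ {d : ℕ} (G : Fin d → Fin d → ℝ) : Fin d → Fin d → ℝ :=
  fun j i => G j i / G i i

/-- The vector `γ⃗_i`, with components `γ_i^j = log (1 + Q j i * γ i)`. -/
noncomputable def gvec {d : ℕ} (Q : Fin d → Fin d → ℝ) (γ : Fin d → ℝ) (i j : Fin d) : ℝ :=
  Real.log (1 + Q j i * γ i)

/-- The set `Γ`: all `γ ∈ ℝ_+^d` such that for every `i` and every nonzero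
`v ∈ ℝ_+^d` with `v i = 0` one has `γ⃗_i ⬝ v < max_j γ⃗_j ⬝ v`. -/
def GammaSet (d : ℕ) (Q : Fin d → Fin d → ℝ) : Set (Fin d → ℝ) :=
  {γ | (∀ i, 0 ≤ γ i) ∧
    ∀ i : Fin d, ∀ v : Fin d → ℝ, (∀ j, 0 ≤ v j) → v ≠ 0 → v i = 0 →
      (∑ j, gvec Q γ i j * v j) < ⨆ l : Fin d, ∑ j, gvec Q γ l j * v j}

/-- The Laplace transform R_Λ of the jump distribution on the face Λ. -/
noncomputable def RLam {d : ℕ} (lam mu : Fin d → ℝ) (P : Fin d → Fin d → ℝ)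
    (Λ : Finset (Fin d)) (α : Fin d → ℝ) : ℝ :=
  (∑ j, lam j * (Real.exp (α j) - 1))
    + ∑ j ∈ Λ, mu j *
        ((∑ k, P j k * Real.exp (α k - α j)) + (1 - ∑ k, P j k) * Real.exp (-α j) - 1)

/-- The set B_Λ of α with exp(α_i) ≤ Σ_j p_{ij} exp(α_j) + p_{i0} for all i ∉ Λ. -/
def BLam {d : ℕ} (P : Fin d → Fin d → ℝ) (Λ : Finset (Fin d)) : Set (Fin d → ℝ) :=
  {α | ∀ i ∉ Λ, Real.exp (α i) ≤ (∑ j, P i j * Real.exp (α j)) + (1 - ∑ j, P i j)}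

/-- The set J(α) of indices k with exp(α_k) = Σ_j p_{kj} exp(α_j) + p_{k0}. -/
def Jset {d : ℕ} (P : Fin d → Fin d → ℝ) (α : Fin d → ℝ) : Set (Fin d) :=
  {k | Real.exp (α k) = (∑ j, P k j * Real.exp (α j)) + (1 - ∑ j, P k j)}

section Helpers

variable {d : ℕ}

theorem mem_Jset {P : Fin d → Fin d → ℝ} {α : Fin d → ℝ} {k : Fin d} : k ∈ Jset P α ↔
    Real.exp (α k) = (∑ j, P k j * Real.exp (α j)) + (1 - ∑ j, P k j) := by
  simp [Jset]

/-- A left inverse `G` of `I - P` recovers a vector from its image under `I - P`. -/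
theorem green_recover {P G : Fin d → Fin d → ℝ}
    (hG1 : ∀ i k, ∑ j, G i j * ((if j = k then (1 : ℝ) else 0) - P j k)
      = if i = k then 1 else 0) (y : Fin d → ℝ) (i : Fin d) :
    ∑ j, G i j * (y j - ∑ k, P j k * y k) = y i := by
  have h : ∀ j, G i j * (y j - ∑ k, P j k * y k)
      = ∑ k, G i j * ((if j = k then (1 : ℝ) else 0) - P j k) * y k := by
    intro j
    simp [mul_sub, sub_mul, Finset.sum_sub_distrib, Finset.mul_sum, mul_assoc]
  rw [Finset.sum_congr rfl (fun j _ => h j), Finset.sum_comm]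
  simp_rw [← Finset.sum_mul, hG1]
  simp

/-- Subharmonic vectors are nonpositive. -/
theorem nonpos_of_le_sum {P G : Fin d → Fin d → ℝ}
    (hG1 : ∀ i k, ∑ j, G i j * ((if j = k then (1 : ℝ) else 0) - P j k)
      = if i = k then 1 else 0) (hGnn : ∀ i j, 0 ≤ G i j)
    {y : Fin d → ℝ} (hy : ∀ j, y j ≤ ∑ k, P j k * y k) (i : Fin d) : y i ≤ 0 := by
  rw [← green_recover hG1 y i]
  exact Finset.sum_nonpos fun j _ =>
    mul_nonpos_of_nonneg_of_nonpos (hGnn i j) (by linarith [hy j])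

/-- Minimum principle for vectors superharmonic off a state `l`. -/
theorem nonneg_of_sum_le {P G : Fin d → Fin d → ℝ} (hP : ∀ i j, 0 ≤ P i j)
    (hG1 : ∀ i k, ∑ j, G i j * ((if j = k then (1 : ℝ) else 0) - P j k)
      = if i = k then 1 else 0) (hGnn : ∀ i j, 0 ≤ G i j)
    {w : Fin d → ℝ} {l : Fin d} (hl : 0 ≤ w l)
    (hw : ∀ j, j ≠ l → ∑ k, P j k * w k ≤ w j) (i : Fin d) : 0 ≤ w i := by
  have h := nonpos_of_le_sum hG1 hGnn (y := fun j => max (-w j) 0) ?_ i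
  · linarith [le_max_left (-w i) 0]
  intro j
  have h0 : 0 ≤ ∑ k, P j k * max (-w k) 0 :=
    Finset.sum_nonneg fun k _ => mul_nonneg (hP j k) (le_max_right _ _)
  refine max_le ?_ h0
  by_cases hj : j = l
  · subst hj; linarith
  · have h1 : ∑ k, P j k * (-w k) ≤ ∑ k, P j k * max (-w k) 0 :=
      Finset.sum_le_sum fun k _ => mul_le_mul_of_nonneg_left (le_max_left _ _) (hP j k)
    simp only [mul_neg, Finset.sum_neg_distrib] at h1
    linarith [hw j hj]

theorem green_eq {P G : Fin d → Fin d → ℝ}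
    (hG2 : ∀ i k, ∑ j, ((if i = j then (1 : ℝ) else 0) - P i j) * G j k
      = if i = k then 1 else 0) (i k : Fin d) :
    G i k = (if i = k then 1 else 0) + ∑ j, P i j * G j k := by
  have h := hG2 i k
  simp only [sub_mul, Finset.sum_sub_distrib, ite_mul, one_mul, zero_mul,
    Finset.sum_ite_eq, Finset.mem_univ, if_true] at h
  linarith

/-- Row form of `G (I - P) = I`. -/
theorem green_eq_left {P G : Fin d → Fin d → ℝ}
    (hG1 : ∀ i k, ∑ j, G i j * ((if j = k then (1 : ℝ) else 0) - P j k)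
      = if i = k then 1 else 0) (i k : Fin d) :
    ∑ j, G i j * P j k = G i k - if i = k then 1 else 0 := by
  have h := hG1 i k
  simp only [mul_sub, Finset.sum_sub_distrib, mul_ite, mul_one, mul_zero,
    Finset.sum_ite_eq', Finset.mem_univ, if_true] at h
  linarith

theorem green_le_diag {P G : Fin d → Fin d → ℝ} (hP : ∀ i j, 0 ≤ P i j)
    (hP0 : ∀ i, ∑ j, P i j ≤ 1)
    (hG1 : ∀ i k, ∑ j, G i j * ((if j = k then (1 : ℝ) else 0) - P j k)
      = if i = k then 1 else 0)
    (hG2 : ∀ i k, ∑ j, ((if i = j then (1 : ℝ) else 0) - P i j) * G j k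
      = if i = k then 1 else 0)
    (hGnn : ∀ i j, 0 ≤ G i j) (j k : Fin d) : G j k ≤ G k k := by
  have h := nonneg_of_sum_le hP hG1 hGnn (w := fun j => G k k - G j k) (l := k) (by simp) ?_ j
  · simpa using h
  intro j hj
  have h1 := green_eq hG2 j k
  rw [if_neg hj] at h1
  simp only [mul_sub, Finset.sum_sub_distrib, ← Finset.sum_mul]
  nlinarith [hP0 j, hGnn k k]

/-- A walk from `j` to `k` through `l` is a walk from `j` to `k`. -/
theorem green_mul_le {P G : Fin d → Fin d → ℝ} (hP : ∀ i j, 0 ≤ P i j)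
    (hG1 : ∀ i k, ∑ j, G i j * ((if j = k then (1 : ℝ) else 0) - P j k)
      = if i = k then 1 else 0)
    (hG2 : ∀ i k, ∑ j, ((if i = j then (1 : ℝ) else 0) - P i j) * G j k
      = if i = k then 1 else 0)
    (hGnn : ∀ i j, 0 ≤ G i j) (j l k : Fin d) : G j l * G l k ≤ G j k * G l l := by
  have h := nonneg_of_sum_le hP hG1 hGnn (w := fun j => G j k * G l l - G j l * G l k) (l := l)
    (by simp [mul_comm]) ?_ j
  · simpa using h
  intro j hj
  have h1 := green_eq hG2 j k
  have h2 := green_eq hG2 j l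
  rw [if_neg hj] at h2
  have h3 : (0 : ℝ) ≤ if j = k then 1 else 0 := by split_ifs <;> norm_num
  simp only [mul_sub, Finset.sum_sub_distrib, ← mul_assoc, ← Finset.sum_mul]
  rw [h1, h2]
  linarith [mul_nonneg h3 (hGnn l l)]

theorem traffic_eq {P G : Fin d → Fin d → ℝ} {lam ν : Fin d → ℝ}
    (hG2 : ∀ i k, ∑ j, ((if i = j then (1 : ℝ) else 0) - P i j) * G j k
      = if i = k then 1 else 0)
    (hν : ∀ j, ν j = lam j + ∑ i, ν i * P i j) (k : Fin d) :
    ν k = ∑ j, lam j * G j k := by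
  have h1 : ∀ j, lam j = ν j - ∑ i, ν i * P i j := fun j => by linarith [hν j]
  simp_rw [h1, sub_mul, Finset.sum_sub_distrib, Finset.sum_mul]
  rw [Finset.sum_comm, ← Finset.sum_sub_distrib]
  have h2 : ∀ i, ν i * G i k - ∑ j, ν i * P i j * G j k = ν i * if i = k then 1 else 0 := by
    intro i
    have := green_eq hG2 i k
    rw [this, mul_add, Finset.mul_sum]
    simp only [mul_assoc]
    ring
  rw [Finset.sum_congr rfl fun i _ => h2 i]
  simp

theorem traffic_mul_green_le {P G : Fin d → Fin d → ℝ} {lam ν : Fin d → ℝ}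
    (hlam : ∀ i, 0 ≤ lam i) (hP : ∀ i j, 0 ≤ P i j)
    (hG1 : ∀ i k, ∑ j, G i j * ((if j = k then (1 : ℝ) else 0) - P j k)
      = if i = k then 1 else 0)
    (hG2 : ∀ i k, ∑ j, ((if i = j then (1 : ℝ) else 0) - P i j) * G j k
      = if i = k then 1 else 0)
    (hGnn : ∀ i j, 0 ≤ G i j)
    (hν : ∀ j, ν j = lam j + ∑ i, ν i * P i j) (l k : Fin d) :
    ν l * G l k ≤ ν k * G l l := by
  rw [traffic_eq hG2 hν l, traffic_eq hG2 hν k, Finset.sum_mul, Finset.sum_mul]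
  refine Finset.sum_le_sum fun j _ => ?_
  rw [mul_assoc, mul_assoc]
  exact mul_le_mul_of_nonneg_left (green_mul_le hP hG1 hG2 hGnn j l k) (hlam j)

theorem RLam_univ_eq (lam mu : Fin d → ℝ) (P : Fin d → Fin d → ℝ) (α : Fin d → ℝ) :
    RLam lam mu P Finset.univ α = (∑ j, lam j * (Real.exp (α j) - 1))
      + ∑ j, mu j * (Real.exp (-α j) *
        ((∑ k, P j k * Real.exp (α k)) + (1 - ∑ k, P j k)) - 1) := by
  unfold RLam
  congr 1
  refine Finset.sum_congr rfl fun j _ => ?_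
  congr 2
  rw [mul_add, Finset.mul_sum, mul_comm (Real.exp (-α j)) (1 - _)]
  congr 1
  refine Finset.sum_congr rfl fun k _ => ?_
  rw [sub_eq_add_neg, Real.exp_add]
  ring

/-- Jensen's inequality for the exponential with subprobability weights `P j ·`, tilted by `s`. -/
theorem mul_exp_div_le {p s β : Fin d → ℝ} (hp : ∀ k, 0 ≤ p k) (hp0 : ∑ k, p k ≤ 1)
    (hs : ∀ k, 0 < s k) {H b : ℝ} (hH : H = (∑ k, p k * s k) + (1 - ∑ k, p k)) (hH0 : 0 < H) :
    H * Real.exp (((∑ k, p k * s k * β k) - H * b) / H)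
      ≤ Real.exp (-b) * ((∑ k, p k * (s k * Real.exp (β k))) + (1 - ∑ k, p k)) := by
  set D := ((∑ k, p k * s k * β k) - H * b) / H with hD
  have hDH : D * H = (∑ k, p k * s k * β k) - H * b := by rw [hD]; field_simp
  have key : ∀ x : ℝ, Real.exp D * (1 + x - b - D) ≤ Real.exp (-b) * Real.exp x := by
    intro x
    have h := Real.add_one_le_exp (x - b - D)
    have h2 : Real.exp (-b) * Real.exp x = Real.exp D * Real.exp (x - b - D) := by
      rw [← Real.exp_add, ← Real.exp_add]; ring_nf
    rw [h2]
    exact mul_le_mul_of_nonneg_left (by linarith) (Real.exp_pos D).le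
  have h1 : ∑ k, p k * s k * (Real.exp D * (1 + β k - b - D))
      ≤ ∑ k, p k * s k * (Real.exp (-b) * Real.exp (β k)) :=
    Finset.sum_le_sum fun k _ =>
      mul_le_mul_of_nonneg_left (key (β k)) (mul_nonneg (hp k) (hs k).le)
  have h2 := mul_le_mul_of_nonneg_left (key 0) (sub_nonneg.2 hp0)
  have h3 : ∑ k, p k * s k * (Real.exp D * (1 + β k - b - D))
      = Real.exp D * ((∑ k, p k * s k * β k) + (1 - b - D) * ∑ k, p k * s k) := by
    rw [Finset.mul_sum, ← Finset.sum_add_distrib, Finset.mul_sum]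
    exact Finset.sum_congr rfl fun k _ => by ring
  have h4 : ∑ k, p k * s k * (Real.exp (-b) * Real.exp (β k))
      = Real.exp (-b) * ∑ k, p k * (s k * Real.exp (β k)) := by
    rw [Finset.mul_sum]
    exact Finset.sum_congr rfl fun k _ => by ring
  rw [h3, h4] at h1
  rw [Real.exp_zero, mul_one] at h2
  have h5 : ∑ k, p k * s k = H - (1 - ∑ k, p k) := by linarith
  have h6 : H * Real.exp D = Real.exp D * ((∑ k, p k * s k * β k)
      + (1 - b - D) * ∑ k, p k * s k)
      + (1 - ∑ k, p k) * (Real.exp D * (1 + 0 - b - D)) := by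
    rw [h5]; linear_combination Real.exp D * hDH
  rw [h6, mul_add]
  linarith

/-- Comparison of `R` at a point of `B_{{o}}` with its value at the critical point
`log s` of the minorant obtained from multipliers `θ`. -/
theorem lt_RLam_of_multipliers {lam mu : Fin d → ℝ} {P : Fin d → Fin d → ℝ}
    (hlam : ∀ i, 0 ≤ lam i) (hmu : ∀ i, 0 < mu i)
    (hP : ∀ i j, 0 ≤ P i j) (hP0 : ∀ i, ∑ j, P i j ≤ 1)
    {o i : Fin d} {s H θ α : Fin d → ℝ} (hs : ∀ k, 0 < s k)
    (hH : ∀ j, H j = (∑ k, P j k * s k) + (1 - ∑ k, P j k)) (hH0 : ∀ j, 0 < H j)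
    (hHs : ∀ j, j ≠ o → H j = s j) (hθ : ∀ j, 0 < θ j)
    (hθo : θ o * s o = mu o) (hθle : ∀ j, j ≠ o → θ j * s j ≤ mu j)
    (hcrit : ∀ k, lam k * s k + (∑ j, θ j * P j k) * s k = θ k * H k)
    (hα : α ∈ BLam P {o}) (hio : i ≠ o) (hi : i ∉ Jset P α) :
    (∑ j, lam j * (s j - 1)) + ∑ j, mu j * (H j / s j - 1) < RLam lam mu P Finset.univ α := by
  rw [RLam_univ_eq]
  set β : Fin d → ℝ := fun k => α k - Real.log (s k) with hβ
  have hexp : ∀ k, Real.exp (α k) = s k * Real.exp (β k) := by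
    intro k
    rw [hβ]
    simp only [Real.exp_sub, Real.exp_log (hs k)]
    field_simp [(hs k).ne']
  set K : Fin d → ℝ := fun j => (∑ k, P j k * Real.exp (α k)) + (1 - ∑ k, P j k) with hK
  set D : Fin d → ℝ := fun j => (∑ k, P j k * s k * β k) - H j * β j with hD
  have hKeq : ∀ j, Real.exp (-α j) * K j = Real.exp (-β j) * K j / s j := by
    intro j
    rw [Real.exp_neg, Real.exp_neg, hexp j]
    field_simp
  have hjen : ∀ j, H j * Real.exp (D j / H j) ≤ Real.exp (-β j) * K j := by
    intro j
    have := mul_exp_div_le (β := β) (b := β j) (hP j) (hP0 j) hs (hH j) (hH0 j)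
    simp only [hK, hexp]
    exact this
  have hlin : ∀ j, H j + D j ≤ H j * Real.exp (D j / H j) := by
    intro j
    have h1 := mul_le_mul_of_nonneg_left (Real.add_one_le_exp (D j / H j)) (hH0 j).le
    have h2 : H j * (D j / H j + 1) = H j + D j := by field_simp [(hH0 j).ne']; ring
    linarith
  have hge : ∀ j, j ≠ o → 1 ≤ Real.exp (-α j) * K j := by
    intro j hj
    have h := hα j (by simpa using hj)
    rw [Real.exp_neg, inv_mul_eq_div, le_div_iff₀ (Real.exp_pos _), one_mul]
    exact h
  have hgt : 1 < Real.exp (-α i) * K i := by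
    refine lt_of_le_of_ne (hge i hio) fun h => hi (mem_Jset.2 ?_)
    rw [Real.exp_neg, inv_mul_eq_div, eq_div_iff (Real.exp_pos _).ne', one_mul] at h
    exact h
  have hterm : ∀ j, mu j * (H j / s j - 1) + θ j * D j
      ≤ mu j * (Real.exp (-α j) * K j - 1) := by
    intro j
    have h1 := (hlin j).trans (hjen j)
    have h2 : (H j + D j) / s j ≤ Real.exp (-α j) * K j := by
      rw [hKeq]; exact div_le_div_of_nonneg_right h1 (hs j).le
    have hsj := (hs j).ne'
    by_cases hj : j = o
    · subst hj
      have h3 := mul_le_mul_of_nonneg_left h2 (hmu j).le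
      have h4 : mu j * ((H j + D j) / s j) = mu j * (H j / s j) + θ j * D j := by
        rw [← hθo]; field_simp
      linarith
    · rw [hHs j hj] at h2 ⊢
      have h3 := mul_le_mul_of_nonneg_right (hθle j hj) (sub_nonneg.2 (hge j hj))
      have h4 := mul_le_mul_of_nonneg_left h2 (mul_pos (hθ j) (hs j)).le
      have h5 : θ j * s j * ((s j + D j) / s j) = θ j * s j + θ j * D j := by field_simp
      rw [div_self hsj]
      linarith
  have hstrict : mu i * (H i / s i - 1) + θ i * D i
      < mu i * (Real.exp (-α i) * K i - 1) := by
    have hsi := (hs i).ne'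
    have h2 : (H i + D i) / s i < Real.exp (-α i) * K i := by
      by_cases h0 : D i = 0
      · rw [h0, add_zero, hHs i hio, div_self hsi]; exact hgt
      · rw [hKeq]
        refine div_lt_div_of_pos_right (lt_of_lt_of_le ?_ (hjen i)) (hs i)
        have h1 := mul_lt_mul_of_pos_left
          (Real.add_one_lt_exp (div_ne_zero h0 (hH0 i).ne')) (hH0 i)
        have h3 : H i * (D i / H i + 1) = H i + D i := by field_simp [(hH0 i).ne']; ring
        linarith
    rw [hHs i hio] at h2 ⊢
    have h3 := mul_le_mul_of_nonneg_right (hθle i hio) (sub_nonneg.2 (hge i hio))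
    have h4 := mul_lt_mul_of_pos_left h2 (mul_pos (hθ i) (hs i))
    have h5 : θ i * s i * ((s i + D i) / s i) = θ i * s i + θ i * D i := by field_simp
    rw [div_self hsi]
    linarith
  have hsum := Finset.sum_lt_sum (fun j _ => hterm j) ⟨i, Finset.mem_univ i, hstrict⟩
  have hlamsum : ∑ j, (lam j * (s j - 1) + lam j * s j * β j)
      ≤ ∑ j, lam j * (Real.exp (α j) - 1) := by
    refine Finset.sum_le_sum fun j _ => ?_
    rw [hexp]
    have h1 := mul_le_mul_of_nonneg_left (Real.add_one_le_exp (β j))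
      (mul_nonneg (hlam j) (hs j).le)
    linarith
  rw [Finset.sum_add_distrib] at hsum hlamsum
  have hzero : ∑ j, lam j * s j * β j + ∑ j, θ j * D j = 0 := by
    have h1 : ∑ j, θ j * D j = ∑ k, ((∑ j, θ j * P j k) * s k - θ k * H k) * β k := by
      simp only [hD, mul_sub, sub_mul, Finset.sum_sub_distrib, Finset.mul_sum, Finset.sum_mul]
      rw [Finset.sum_comm]
      congr 1
      · exact Finset.sum_congr rfl fun _ _ => Finset.sum_congr rfl fun _ _ => by ring
      · exact Finset.sum_congr rfl fun _ _ => by ring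
    rw [h1, ← Finset.sum_add_distrib]
    exact Finset.sum_eq_zero fun k _ => by linear_combination β k * hcrit k
  linarith

/-- The multiplier bound: `a, b, m` are square roots of `ν_1, ν_k, μ_k`, `x = G_{1k}`,
`y = G_{k1}`, `e = (√μ_1 - √ν_1) / G_{11}`. -/
theorem multiplier_le {a b m e x y g h : ℝ} (ha : 0 < a) (hb : 0 < b) (hbm : b ≤ m)
    (he : 0 ≤ e) (hx : 0 ≤ x) (hy : 0 ≤ y) (hg : 0 < g) (hh : 0 < h)
    (hxh : x ≤ h) (hyg : y ≤ g) (hxy : x * y ≤ g * h)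
    (hax : a ^ 2 * x ≤ b ^ 2 * g) (hby : b ^ 2 * y ≤ a ^ 2 * h)
    (hm : g * e ^ 2 ≤ 1 / h * (m - b) ^ 2) :
    (b ^ 2 + a * e * x) * (1 + y * (e / a)) ≤ m ^ 2 := by
  have hm' : (g * h) * e ^ 2 ≤ (m - b) ^ 2 := by
    rw [one_div, inv_mul_eq_div, le_div_iff₀ hh] at hm
    linarith
  set r := Real.sqrt (g * h) with hr
  have hr2 : r ^ 2 = g * h := Real.sq_sqrt (mul_pos hg hh).le
  have hr0 : 0 ≤ r := Real.sqrt_nonneg _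
  have h1 : r * e ≤ m - b := by
    refine abs_le_of_sq_le_sq' ?_ (sub_nonneg.2 hbm) |>.2
    rw [mul_pow, hr2]; exact hm'
  have h2 : a * x ≤ b * r := by
    refine abs_le_of_sq_le_sq' ?_ (mul_nonneg hb.le hr0) |>.2
    rw [mul_pow, mul_pow, hr2]
    calc a ^ 2 * x ^ 2 = (a ^ 2 * x) * x := by ring
      _ ≤ (b ^ 2 * g) * h := mul_le_mul hax hxh hx (by positivity)
      _ = _ := by ring
  have h3 : b * y / a ≤ r := by
    refine abs_le_of_sq_le_sq' ?_ hr0 |>.2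
    rw [hr2, div_pow, div_le_iff₀ (by positivity)]
    calc (b * y) ^ 2 = (b ^ 2 * y) * y := by ring
      _ ≤ (a ^ 2 * h) * g := mul_le_mul hby hyg hy (by positivity)
      _ = _ := by ring
  have h4 : (b ^ 2 + a * e * x) * (1 + y * (e / a))
      = b ^ 2 + e * (a * x) + e * b * (b * y / a) + e ^ 2 * (x * y) := by
    field_simp
    ring
  have h5 : e * (a * x) ≤ e * (b * r) := mul_le_mul_of_nonneg_left h2 he
  have h6 : e * b * (b * y / a) ≤ e * b * r := mul_le_mul_of_nonneg_left h3 (by positivity)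
  have h7 : e ^ 2 * (x * y) ≤ e ^ 2 * r ^ 2 := by
    rw [hr2]; exact mul_le_mul_of_nonneg_left hxy (by positivity)
  have h8 : (b + r * e) ^ 2 ≤ m ^ 2 := by
    apply pow_le_pow_left₀ (by positivity); linarith
  rw [h4]
  nlinarith

/-- On the set where every `u_j := ((I - P) e^α)_j - p_{j0}` is nonpositive and one is
negative, `R` is positive. -/
theorem RLam_pos_of_subharmonic {lam mu : Fin d → ℝ} {P G : Fin d → Fin d → ℝ}
    {ν : Fin d → ℝ} (hmu : ∀ i, 0 < mu i)
    (hG1 : ∀ i k, ∑ j, G i j * ((if j = k then (1 : ℝ) else 0) - P j k)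
      = if i = k then 1 else 0) (hGnn : ∀ i j, 0 ≤ G i j)
    (hν : ∀ j, ν j = lam j + ∑ i, ν i * P i j) (hB : ∀ i, ν i < mu i)
    {α : Fin d → ℝ} {i : Fin d} (hi : i ∉ Jset P α)
    (hα : ∀ j, Real.exp (α j) ≤ (∑ k, P j k * Real.exp (α k)) + (1 - ∑ k, P j k)) :
    0 < RLam lam mu P Finset.univ α := by
  rw [RLam_univ_eq]
  set K : Fin d → ℝ := fun j => (∑ k, P j k * Real.exp (α k)) + (1 - ∑ k, P j k) with hK
  have hx : ∀ j, Real.exp (α j) ≤ 1 := by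
    intro j
    have h := nonpos_of_le_sum hG1 hGnn (y := fun j => Real.exp (α j) - 1) ?_ j
    · linarith
    intro j
    simp only [mul_sub, Finset.sum_sub_distrib, mul_one]
    linarith [hα j]
  have hlam : ∑ j, lam j * (Real.exp (α j) - 1) = ∑ j, ν j * (Real.exp (α j) - K j) := by
    have h1 : ∀ j, lam j = ν j - ∑ i, ν i * P i j := fun j => by linarith [hν j]
    simp only [h1, hK, sub_mul, mul_sub, mul_add, Finset.sum_sub_distrib, Finset.sum_add_distrib,
      Finset.sum_mul, Finset.mul_sum, mul_one]
    rw [Finset.sum_comm (f := fun j i => ν i * P i j * Real.exp (α j)),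
      Finset.sum_comm (f := fun j i => ν i * P i j)]
    simp only [mul_assoc]
    ring
  have hge : ∀ j, K j - Real.exp (α j) ≤ Real.exp (-α j) * K j - 1 := by
    intro j
    have h2 : 1 ≤ Real.exp (-α j) := by
      rw [Real.exp_neg]; exact (one_le_inv₀ (Real.exp_pos _)).2 (hx j)
    have h3 : Real.exp (-α j) * Real.exp (α j) = 1 := by rw [← Real.exp_add]; simp
    nlinarith [hα j]
  rw [hlam, ← Finset.sum_add_distrib]
  have hbase : ∀ j, (mu j - ν j) * (K j - Real.exp (α j))
      ≤ ν j * (Real.exp (α j) - K j) + mu j * (Real.exp (-α j) * K j - 1) := by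
    intro j
    have := mul_le_mul_of_nonneg_left (hge j) (hmu j).le
    linarith
  refine Finset.sum_pos' (fun j _ => ?_) ⟨i, Finset.mem_univ i, ?_⟩
  · exact (mul_nonneg (sub_pos.2 (hB j)).le (sub_nonneg.2 (hα j))).trans (hbase j)
  · exact (mul_pos (sub_pos.2 (hB i)) (sub_pos.2 (lt_of_le_of_ne (hα i) (mt mem_Jset.2 hi)))).trans_le (hbase i)

end Helpers

/-- Lemma 7.1: if the minimum of (1/G_ii)(√μ_i - √ν_i)² is attained at the first index,
α ∈ B_{{1}} and {2,…,d} \ J(α) ≠ ∅, then for any i ≠ 1 with i ∉ J(α) there is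
α̃ ∈ B_{{1}} with J(α) ∪ {i} ⊆ J(α̃) and
R(α̃) < max {R(α), -(1/G_ii)(√μ_i - √ν_i)²}. -/
theorem stmt6
    (d : ℕ) (hd : 0 < d)
    (lam mu : Fin d → ℝ) (P : Fin d → Fin d → ℝ)
    (hlam : ∀ i, 0 ≤ lam i) (hmu : ∀ i, 0 < mu i)
    (hP : ∀ i j, 0 ≤ P i j) (hPdiag : ∀ i, P i i = 0) (hP0 : ∀ i, ∑ j, P i j ≤ 1)
    (hA : AssumptionA lam mu P)
    (G : Fin d → Fin d → ℝ)
    (hG1 : ∀ i k, ∑ j, G i j * ((if j = k then (1 : ℝ) else 0) - P j k)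
      = if i = k then 1 else 0)
    (hG2 : ∀ i k, ∑ j, ((if i = j then (1 : ℝ) else 0) - P i j) * G j k
      = if i = k then 1 else 0)
    (hGnn : ∀ i j, 0 ≤ G i j) (hGdiag : ∀ i, 1 ≤ G i i)
    (ν : Fin d → ℝ) (hν : ∀ j, ν j = lam j + ∑ i, ν i * P i j) (hνpos : ∀ i, 0 < ν i)
    (hB : ∀ i, ν i < mu i)
    (hmin : (⨅ i : Fin d, 1 / G i i * (Real.sqrt (mu i) - Real.sqrt (ν i)) ^ 2)
      = 1 / G ⟨0, hd⟩ ⟨0, hd⟩ *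
          (Real.sqrt (mu ⟨0, hd⟩) - Real.sqrt (ν ⟨0, hd⟩)) ^ 2)
    (α : Fin d → ℝ) (hα : α ∈ BLam P {(⟨0, hd⟩ : Fin d)})
    (hne : ∃ i : Fin d, i ≠ ⟨0, hd⟩ ∧ i ∉ Jset P α) :
    ∀ i : Fin d, i ≠ ⟨0, hd⟩ → i ∉ Jset P α →
      ∃ α' : Fin d → ℝ, α' ∈ BLam P {(⟨0, hd⟩ : Fin d)}
        ∧ Jset P α ∪ {i} ⊆ Jset P α'
        ∧ RLam lam mu P Finset.univ α'
            < max (RLam lam mu P Finset.univ α)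
                (-(1 / G i i * (Real.sqrt (mu i) - Real.sqrt (ν i)) ^ 2)) := by
  intro i hio hi
  set o : Fin d := ⟨0, hd⟩ with ho
  by_cases hJo : o ∈ Jset P α
  · refine ⟨fun _ => 0, ?_, ?_, ?_⟩
    · intro j _
      simp
    · intro j _
      simp [mem_Jset]
    · have h0 : RLam lam mu P Finset.univ (fun _ => 0) = 0 := by simp [RLam]
      rw [h0]
      refine lt_max_of_lt_left (RLam_pos_of_subharmonic hmu hG1 hGnn hν hB hi fun j => ?_)
      by_cases hj : j = o
      · rw [hj]; exact le_of_eq (mem_Jset.1 hJo)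
      · exact hα j (by simpa using hj)
  set a := Real.sqrt (ν o) with ha
  set c := Real.sqrt (mu o) with hc
  have ha0 : 0 < a := Real.sqrt_pos.2 (hνpos o)
  have ha2 : a ^ 2 = ν o := Real.sq_sqrt (hνpos o).le
  have hc2 : c ^ 2 = mu o := Real.sq_sqrt (hmu o).le
  have hac : a ≤ c := Real.sqrt_le_sqrt (hB o).le
  have hg : 0 < G o o := lt_of_lt_of_le one_pos (hGdiag o)
  set e := (c - a) / G o o with he
  have he0 : 0 ≤ e := div_nonneg (sub_nonneg.2 hac) hg.le
  have hge : G o o * e = c - a := by rw [he]; field_simp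
  set t := e / a with ht
  have hat : a * t = e := by rw [ht]; field_simp
  have ht0 : 0 ≤ t := div_nonneg he0 ha0.le
  set s : Fin d → ℝ := fun j => 1 + G j o * t with hs
  have hs0 : ∀ j, 0 < s j := fun j => by
    have := mul_nonneg (hGnn j o) ht0
    simp only [hs]; linarith
  have has : a * s o = c := by
    simp only [hs]; linear_combination G o o * hat + hge
  set H : Fin d → ℝ := fun j => (∑ k, P j k * s k) + (1 - ∑ k, P j k) with hH
  have hHeq : ∀ j, H j = s j - if j = o then t else 0 := by
    intro j
    have h1 := green_eq hG2 j o
    simp only [hH, hs, mul_add, mul_one, Finset.sum_add_distrib, ← mul_assoc, ← Finset.sum_mul]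
    rw [h1]
    split_ifs <;> ring
  have hHs : ∀ j, j ≠ o → H j = s j := fun j hj => by simp [hHeq, hj]
  have hH0 : ∀ j, 0 < H j := by
    intro j
    have h1 : ∑ k, P j k * 1 ≤ ∑ k, P j k * s k := by
      refine Finset.sum_le_sum fun k _ => mul_le_mul_of_nonneg_left ?_ (hP j k)
      have := mul_nonneg (hGnn k o) ht0
      simp only [hs]; linarith
    simp only [mul_one] at h1
    simp only [hH]
    linarith
  set θ : Fin d → ℝ := fun k => ν k + ν o * t * G o k with hθ
  have hθ0 : ∀ k, 0 < θ k := fun k => by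
    have := mul_nonneg (mul_nonneg (hνpos o).le ht0) (hGnn o k)
    have := hνpos k
    simp only [hθ]; linarith
  have hθs : θ o = ν o * s o := by simp only [hθ, hs]; ring
  have hθo : θ o * s o = mu o := by
    rw [hθs, ← ha2, ← hc2, ← has]; ring
  have hmle : ∀ k, 1 / G o o * (c - a) ^ 2
      ≤ 1 / G k k * (Real.sqrt (mu k) - Real.sqrt (ν k)) ^ 2 := by
    intro k
    rw [← hmin]
    exact ciInf_le (Set.finite_range _).bddBelow k
  have hmo : 1 / G o o * (c - a) ^ 2 = G o o * e ^ 2 := by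
    rw [← hge]; field_simp
  have hθle : ∀ k, k ≠ o → θ k * s k ≤ mu k := by
    intro k _
    have hb2 := Real.sq_sqrt (hνpos k).le
    have hm2 := Real.sq_sqrt (hmu k).le
    have h := multiplier_le (a := a) (b := Real.sqrt (ν k)) (m := Real.sqrt (mu k)) (e := e)
      (x := G o k) (y := G k o) (g := G o o) (h := G k k) ha0 (Real.sqrt_pos.2 (hνpos k))
      (Real.sqrt_le_sqrt (hB k).le) he0 (hGnn o k) (hGnn k o) hg
      (lt_of_lt_of_le one_pos (hGdiag k)) (green_le_diag hP hP0 hG1 hG2 hGnn o k)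
      (green_le_diag hP hP0 hG1 hG2 hGnn k o) (green_mul_le hP hG1 hG2 hGnn o k o)
      (by rw [ha2, hb2]; exact traffic_mul_green_le hlam hP hG1 hG2 hGnn hν o k)
      (by rw [ha2, hb2]; exact traffic_mul_green_le hlam hP hG1 hG2 hGnn hν k o)
      (by rw [← hmo]; exact hmle k)
    rw [hb2, hm2] at h
    convert h using 2
    simp only [hθ]
    rw [← ha2, ← hat]; ring
  have hcrit : ∀ k, lam k * s k + (∑ j, θ j * P j k) * s k = θ k * H k := by
    intro k
    have h1 : ∑ j, θ j * P j k
        = (ν k - lam k) + ν o * t * (G o k - if o = k then 1 else 0) := by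
      rw [← green_eq_left hG1 o k, hν k, Finset.mul_sum, add_sub_cancel_left,
        ← Finset.sum_add_distrib]
      exact Finset.sum_congr rfl fun j _ => by simp only [hθ]; ring
    rw [h1, hHeq]
    by_cases hk : k = o
    · subst hk
      simp only [if_true]
      rw [hθs]
      simp only [hs]
      ring
    · rw [if_neg hk, if_neg (Ne.symm hk)]
      simp only [hθ]; ring
  have hlow := lt_RLam_of_multipliers hlam hmu hP hP0 hs0 (fun _ => rfl) hH0 hHs hθ0 hθo hθle
    hcrit hα hio hi
  have hexp : ∀ k, Real.exp (Real.log (s k)) = s k := fun k => Real.exp_log (hs0 k)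
  refine ⟨fun k => Real.log (s k), ?_, ?_, lt_max_of_lt_left ?_⟩
  · intro j hj
    simp only [hexp]
    exact (hHs j (by simpa using hj)).ge
  · intro j hj
    have hjo : j ≠ o := by
      rintro rfl
      rcases hj with hj | hj
      · exact hJo hj
      · exact hio hj.symm
    simp only [mem_Jset, hexp]
    exact (hHs j hjo).symm
  · refine lt_of_eq_of_lt ?_ hlow
    rw [RLam_univ_eq]
    simp only [hexp, Real.exp_neg, inv_mul_eq_div]
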